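/- Let A be an order-k real tensor with all mode dimensions equal to d (d ≥ 1), and let 1 ≤ ℓ ≤ k. Then d^{−(k−ℓ)/2} · max_{π ∈ P^ℓ_{[k]}} ‖Unfold_π(A)‖_σ ≤ ‖A‖_σ ≤ min_{π ∈ P^ℓ_{[k]}} ‖Unfold_π(A)‖_σ, where P^ℓ_{[k]} denotes the set of partitions of [k] with exactly ℓ blocks. -/

import Mathlib

open scoped BigOperators ENNReal

namespace TensorUnfolding

/-- The vector `l^p` norm of a finitely-indexed real vector, for `p ∈ [1, ∞]`
(for `p = ∞` it is the maximum of the absolute values of the entries). -/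
noncomputable def pNorm (p : ℝ≥0∞) {ι : Type} [Fintype ι] (x : ι → ℝ) : ℝ :=
  if p = ⊤ then ⨆ i, |x i| else (∑ i, |x i| ^ p.toReal) ^ (1 / p.toReal)

/-- `π` is a partition of `[k] = {0, …, k-1}`: a collection of disjoint nonempty
blocks whose union is all of `Fin k`. -/
def IsPartition {k : ℕ} (π : Finset (Finset (Fin k))) : Prop :=
  (∀ B ∈ π, B.Nonempty) ∧
  (∀ B ∈ π, ∀ B' ∈ π, B ≠ B' → Disjoint B B') ∧
  π.sup id = Finset.univ

/-- `π₁ ≤ π₂`: every block of `π₁` is contained in some block of `π₂`. -/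
def Refines {k : ℕ} (π₁ π₂ : Finset (Finset (Fin k))) : Prop :=
  ∀ B ∈ π₁, ∃ B' ∈ π₂, B ⊆ B'

/-- The finest partition `0_{[k]} = {{1}, …, {k}}`. -/
def botPartition (k : ℕ) : Finset (Finset (Fin k)) :=
  Finset.univ.image fun n => {n}

/-- The coarsest (one-block) partition `1_{[k]} = {[k]}`. -/
def topPartition (k : ℕ) : Finset (Finset (Fin k)) :=
  {Finset.univ}

/-- The meet `π₁ ∧ π₂`: the partition whose blocks are the nonempty
intersections `B ∩ B'` with `B ∈ π₁`, `B' ∈ π₂`. -/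
def meetPartition {k : ℕ} (π₁ π₂ : Finset (Finset (Fin k))) : Finset (Finset (Fin k)) :=
  ((π₁ ×ˢ π₂).image fun p => p.1 ∩ p.2).filter fun B => B.Nonempty

/-- The `l^p` operator norm of the unfolding of the tensor `A` induced by the
partition `π`: the supremum of `⟨A, ⊗_{B ∈ π} y_B⟩` over choices, for each block
`B ∈ π`, of a vector `y_B` indexed by `Π_{j ∈ B} Fin (d j)` with `l^p` norm 1. -/
noncomputable def unfoldNormP {k : ℕ} (p : ℝ≥0∞) (d : Fin k → ℕ)
    (A : ((n : Fin k) → Fin (d n)) → ℝ) (π : Finset (Finset (Fin k))) : ℝ :=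
  sSup { r : ℝ |
    ∃ y : (B : Finset (Fin k)) → ((j : B) → Fin (d j.1)) → ℝ,
      (∀ B ∈ π, pNorm p (y B) = 1) ∧
      r = ∑ i : (n : Fin k) → Fin (d n), A i * ∏ B ∈ π, y B fun j => i j.1 }

/-- The spectral norm of the unfolding of the tensor `A` induced by the
partition `π`: the supremum of `⟨A, ⊗_{B ∈ π} y_B⟩` over choices, for each block
`B ∈ π`, of a vector `y_B` indexed by `Π_{j ∈ B} Fin (d j)` with Euclidean norm 1. -/
noncomputable def unfoldNorm {k : ℕ} (d : Fin k → ℕ)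
    (A : ((n : Fin k) → Fin (d n)) → ℝ) (π : Finset (Finset (Fin k))) : ℝ :=
  sSup { r : ℝ |
    ∃ y : (B : Finset (Fin k)) → ((j : B) → Fin (d j.1)) → ℝ,
      (∀ B ∈ π, ∑ v, (y B v) ^ 2 = 1) ∧
      r = ∑ i : (n : Fin k) → Fin (d n), A i * ∏ B ∈ π, y B fun j => i j.1 }

/-- The `l^p` operator norm of the tensor `A`:
`‖A‖_p = sup { A(x₁, …, x_k) : ‖x_n‖_p = 1 }`. -/
noncomputable def opNormP {k : ℕ} (p : ℝ≥0∞) (d : Fin k → ℕ)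
    (A : ((n : Fin k) → Fin (d n)) → ℝ) : ℝ :=
  sSup { r : ℝ | ∃ x : (n : Fin k) → Fin (d n) → ℝ,
    (∀ n, pNorm p (x n) = 1) ∧
    r = ∑ i : (n : Fin k) → Fin (d n), A i * ∏ n, x n (i n) }

/-- The spectral norm of the tensor `A`:
`‖A‖_σ = sup { A(x₁, …, x_k) : ‖x_n‖₂ = 1 }`. -/
noncomputable def specNorm {k : ℕ} (d : Fin k → ℕ)
    (A : ((n : Fin k) → Fin (d n)) → ℝ) : ℝ :=
  sSup { r : ℝ | ∃ x : (n : Fin k) → Fin (d n) → ℝ,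
    (∀ n, ∑ i, (x n i) ^ 2 = 1) ∧
    r = ∑ i : (n : Fin k) → Fin (d n), A i * ∏ n, x n (i n) }

/-- The Frobenius norm of the tensor `A`. -/
noncomputable def frobNorm {k : ℕ} (d : Fin k → ℕ)
    (A : ((n : Fin k) → Fin (d n)) → ℝ) : ℝ :=
  Real.sqrt (∑ i : (n : Fin k) → Fin (d n), (A i) ^ 2)

/-- `D_A(B, B') = Π_{n ∈ B ∩ B'} d_n` if `B ∩ B' ≠ ∅`, and `0` otherwise. -/
def blockDim {k : ℕ} (d : Fin k → ℕ) (B B' : Finset (Fin k)) : ℕ :=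
  if (B ∩ B').Nonempty then ∏ n ∈ B ∩ B', d n else 0

/-- `dim_A(π₁, π₂) = Π_{B ∈ π₁} max_{B' ∈ π₂} D_A(B, B')`. -/
def dimRel {k : ℕ} (d : Fin k → ℕ) (π₁ π₂ : Finset (Finset (Fin k))) : ℕ :=
  ∏ B ∈ π₁, π₂.sup fun B' => blockDim d B B'

/-- `A` is `π`-orthogonal decomposable: `A = Σ_{n=1}^r λ_n a₁⁽ⁿ⁾ ⊗ ⋯ ⊗ a_k⁽ⁿ⁾`
with `λ₁ ≥ ⋯ ≥ λ_r ≥ 0` and `Π_{i ∈ B} ⟨a_i⁽ⁿ⁾, a_i⁽ᵐ⁾⟩ = δ_{nm}` for every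
block `B ∈ π`. -/
def IsPiOD {k : ℕ} (d : Fin k → ℕ) (A : ((n : Fin k) → Fin (d n)) → ℝ)
    (π : Finset (Finset (Fin k))) : Prop :=
  ∃ (r : ℕ) (lam : Fin r → ℝ) (a : Fin r → (n : Fin k) → Fin (d n) → ℝ),
    Antitone lam ∧ (∀ n, 0 ≤ lam n) ∧
    (∀ i, A i = ∑ n, lam n * ∏ m, a n m (i m)) ∧
    (∀ B ∈ π, ∀ n m : Fin r,
      (∏ j ∈ B, ∑ t, a n j t * a m j t) = if n = m then 1 else 0)

end TensorUnfolding

namespace TensorUnfolding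

variable {k : ℕ} {d : Fin k → ℕ}

section Partition

variable {π : Finset (Finset (Fin k))}

theorem IsPartition.exists_mem (hπ : IsPartition π) (n : Fin k) : ∃ B ∈ π, n ∈ B := by
  have h : n ∈ π.sup id := hπ.2.2 ▸ Finset.mem_univ n
  simpa [Finset.mem_sup] using h

theorem IsPartition.eq_of_mem (hπ : IsPartition π) {B B' : Finset (Fin k)} (hB : B ∈ π)
    (hB' : B' ∈ π) {n : Fin k} (h : n ∈ B) (h' : n ∈ B') : B = B' := by
  by_contra hne
  exact Finset.disjoint_left.1 (hπ.2.1 B hB B' hB' hne) h h'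

/-- The block of a partition containing a given index. -/
noncomputable def IsPartition.block (hπ : IsPartition π) (n : Fin k) : Finset (Fin k) :=
  (hπ.exists_mem n).choose

theorem IsPartition.block_mem (hπ : IsPartition π) (n : Fin k) : hπ.block n ∈ π :=
  (hπ.exists_mem n).choose_spec.1

theorem IsPartition.mem_block (hπ : IsPartition π) (n : Fin k) : n ∈ hπ.block n :=
  (hπ.exists_mem n).choose_spec.2

theorem IsPartition.block_eq (hπ : IsPartition π) {B : Finset (Fin k)} (hB : B ∈ π) {n : Fin k}
    (h : n ∈ B) : hπ.block n = B :=
  hπ.eq_of_mem (hπ.block_mem n) hB (hπ.mem_block n) h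

/-- A multi-index is the same as a family of multi-indices, one for each block. -/
noncomputable def IsPartition.piEquiv (hπ : IsPartition π) (d : Fin k → ℕ) :
    ((n : Fin k) → Fin (d n)) ≃ ((B : π) → (j : B.1) → Fin (d j.1)) where
  toFun i _ j := i j.1
  invFun v n := v ⟨hπ.block n, hπ.block_mem n⟩ ⟨n, hπ.mem_block n⟩
  left_inv _ := rfl
  right_inv v := by
    funext ⟨B, hB⟩ ⟨j, hj⟩
    obtain rfl := hπ.block_eq hB hj
    rfl

theorem IsPartition.sum_prod_block (hπ : IsPartition π)
    (f : (B : Finset (Fin k)) → ((j : B) → Fin (d j.1)) → ℝ) :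
    ∑ i : (n : Fin k) → Fin (d n), ∏ B ∈ π, f B (fun j => i j.1) = ∏ B ∈ π, ∑ v, f B v := by
  rw [← Finset.prod_coe_sort π (fun B => ∑ v, f B v), Fintype.prod_sum,
    ← Equiv.sum_comp (hπ.piEquiv d)]
  refine Finset.sum_congr rfl fun i _ => ?_
  rw [← Finset.prod_coe_sort π]
  rfl

theorem IsPartition.prod_prod_block (hπ : IsPartition π) (f : Fin k → ℝ) :
    ∏ B ∈ π, ∏ j : B, f j.1 = ∏ n, f n := by
  have h : (Finset.univ : Finset (Fin k)) = π.biUnion id := by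
    rw [← hπ.2.2, Finset.sup_eq_biUnion]
  rw [h, Finset.prod_biUnion (t := id) fun B hB B' hB' hne => hπ.2.1 B hB B' hB' hne]
  exact Finset.prod_congr rfl fun B _ => Finset.prod_coe_sort B f

end Partition

theorem abs_le_one_of_sum_sq_eq_one {ι : Type*} [Fintype ι] {x : ι → ℝ}
    (hx : ∑ i, x i ^ 2 = 1) (i : ι) : |x i| ≤ 1 := by
  rw [← sq_le_one_iff_abs_le_one, ← hx]
  exact Finset.single_le_sum (f := fun i => x i ^ 2) (fun _ _ => sq_nonneg _) (Finset.mem_univ i)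

theorem exists_sum_sq_eq_one (ι : Type*) [Fintype ι] [Nonempty ι] :
    ∃ x : ι → ℝ, ∑ i, x i ^ 2 = 1 := by
  classical
  obtain ⟨a⟩ := ‹Nonempty ι›
  exact ⟨Pi.single a 1, by simp [Pi.single_apply, ite_pow]⟩

theorem sum_mul_prod_le {ι κ : Type*} [Fintype ι] (A : ι → ℝ) (s : Finset κ) (f : ι → κ → ℝ)
    (hf : ∀ i, ∀ b ∈ s, |f i b| ≤ 1) : ∑ i, A i * ∏ b ∈ s, f i b ≤ ∑ i, |A i| := by
  refine Finset.sum_le_sum fun i _ => (le_abs_self _).trans ?_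
  rw [abs_mul, Finset.abs_prod]
  exact mul_le_of_le_one_right (abs_nonneg _)
    (Finset.prod_le_one (fun _ _ => abs_nonneg _) (hf i))

theorem le_specNorm (A : ((n : Fin k) → Fin (d n)) → ℝ) (x : (n : Fin k) → Fin (d n) → ℝ)
    (hx : ∀ n, ∑ i, x n i ^ 2 = 1) : ∑ i, A i * ∏ n, x n (i n) ≤ specNorm d A := by
  refine le_csSup ⟨∑ i, |A i|, ?_⟩ ⟨x, hx, rfl⟩
  rintro _ ⟨x, hx, rfl⟩
  exact sum_mul_prod_le A _ _ fun i n _ => abs_le_one_of_sum_sq_eq_one (hx n) (i n)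

theorem le_unfoldNorm (A : ((n : Fin k) → Fin (d n)) → ℝ) (π : Finset (Finset (Fin k)))
    (y : (B : Finset (Fin k)) → ((j : B) → Fin (d j.1)) → ℝ)
    (hy : ∀ B ∈ π, ∑ v, y B v ^ 2 = 1) :
    ∑ i : (n : Fin k) → Fin (d n), A i * ∏ B ∈ π, y B (fun j => i j.1) ≤ unfoldNorm d A π := by
  refine le_csSup ⟨∑ i, |A i|, ?_⟩ ⟨y, hy, rfl⟩
  rintro _ ⟨y, hy, rfl⟩
  exact sum_mul_prod_le A _ _ fun i B hB => abs_le_one_of_sum_sq_eq_one (hy B hB) _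

theorem exists_forall_sum_sq_eq_one (hd : ∀ n, 0 < d n) :
    ∃ x : (n : Fin k) → Fin (d n) → ℝ, ∀ n, ∑ i, x n i ^ 2 = 1 := by
  have h n : ∃ x : Fin (d n) → ℝ, ∑ i, x i ^ 2 = 1 := by
    have : Nonempty (Fin (d n)) := ⟨⟨0, hd n⟩⟩
    exact exists_sum_sq_eq_one _
  choose x hx using h
  exact ⟨x, hx⟩

theorem specNorm_nonneg [Nonempty (Fin k)] (hd : ∀ n, 0 < d n)
    (A : ((n : Fin k) → Fin (d n)) → ℝ) : 0 ≤ specNorm d A := by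
  obtain ⟨x, hx⟩ := exists_forall_sum_sq_eq_one hd
  obtain ⟨m⟩ := ‹Nonempty (Fin k)›
  have h₁ := le_specNorm A x hx
  have h₂ := le_specNorm A (fun n t => (if n = m then -1 else 1) * x n t) fun n => by
    split_ifs <;> simpa using hx n
  simp only [Finset.prod_mul_distrib, Finset.prod_ite_eq', Finset.mem_univ, if_true, neg_one_mul,
    mul_neg, Finset.sum_neg_distrib] at h₂
  linarith

theorem specNorm_le_unfoldNorm (hd : ∀ n, 0 < d n) (A : ((n : Fin k) → Fin (d n)) → ℝ)
    {π : Finset (Finset (Fin k))} (hπ : IsPartition π) : specNorm d A ≤ unfoldNorm d A π := by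
  obtain ⟨x₀, hx₀⟩ := exists_forall_sum_sq_eq_one hd
  refine csSup_le ⟨_, x₀, hx₀, rfl⟩ ?_
  rintro _ ⟨x, hx, rfl⟩
  have h := le_unfoldNorm A π (fun B v => ∏ j : B, x j.1 (v j)) fun B _ => by
    simp_rw [← Finset.prod_pow]
    rw [← Fintype.prod_sum (fun (j : B) t => x j.1 t ^ 2)]
    exact Finset.prod_eq_one fun j _ => hx j.1
  refine le_of_eq_of_le (Finset.sum_congr rfl fun i _ => ?_) h
  rw [hπ.prod_prod_block fun n => x n (i n)]

/-- The multilinear form of a tensor is bounded by the spectral norm, for vectors of arbitrary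
length. -/
theorem sum_le_specNorm_mul_prod (A : ((n : Fin k) → Fin (d n)) → ℝ)
    (x : (n : Fin k) → Fin (d n) → ℝ) :
    ∑ i, A i * ∏ n, x n (i n) ≤ specNorm d A * ∏ n, √(∑ t, x n t ^ 2) := by
  by_cases h0 : ∃ n, ∑ t, x n t ^ 2 = 0
  · obtain ⟨n, hn⟩ := h0
    have hx t : x n t = 0 := by
      have := (Finset.sum_eq_zero_iff_of_nonneg fun t _ => sq_nonneg (x n t)).1 hn t
        (Finset.mem_univ t)
      exact pow_eq_zero_iff two_ne_zero |>.1 this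
    rw [Finset.prod_eq_zero (Finset.mem_univ n) (by rw [hn, Real.sqrt_zero]), mul_zero]
    refine (Finset.sum_eq_zero fun i _ => ?_).le
    rw [Finset.prod_eq_zero (Finset.mem_univ n) (hx _), mul_zero]
  · push Not at h0
    have hpos n : 0 < ∑ t, x n t ^ 2 :=
      lt_of_le_of_ne (Finset.sum_nonneg fun t _ => sq_nonneg _) (h0 n).symm
    have h := le_specNorm A (fun n t => x n t / √(∑ t, x n t ^ 2)) fun n => by
      simp_rw [div_pow, Real.sq_sqrt (hpos n).le]
      rw [← Finset.sum_div, div_self (h0 n)]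
    simp_rw [Finset.prod_div_distrib, ← mul_div_assoc] at h
    rwa [← Finset.sum_div, div_le_iff₀
      (Finset.prod_pos fun n _ => Real.sqrt_pos.2 (hpos n))] at h

/-- The multilinear form of a slice of a tensor is bounded by the spectral norm of the tensor. -/
theorem sum_slice_le_specNorm_mul_prod (A : ((n : Fin k) → Fin (d n)) → ℝ) (R : Finset (Fin k))
    (w : (n : {n // ¬ n ∈ R}) → Fin (d n.1))
    (g : (n : {n // n ∈ R}) → Fin (d n.1) → ℝ) :
    ∑ u, A ((Equiv.piEquivPiSubtypeProd (fun n => n ∈ R) (fun n => Fin (d n))).symm (u, w)) *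
        ∏ n, g n (u n) ≤
      specNorm d A * ∏ n, √(∑ t, g n t ^ 2) := by
  have h := sum_le_specNorm_mul_prod A
    fun n => if h : n ∈ R then g ⟨n, h⟩ else Pi.single (w ⟨n, h⟩) 1
  convert h using 1
  · rw [← Equiv.sum_comp (Equiv.piEquivPiSubtypeProd (fun n => n ∈ R) (fun n => Fin (d n))).symm,
      Fintype.sum_prod_type]
    refine Finset.sum_congr rfl fun u _ => ?_
    rw [Finset.sum_eq_single w]
    · rw [← Fintype.prod_subtype_mul_prod_subtype (fun n => n ∈ R)]
      congr 1
      rw [Finset.prod_eq_one (s := (Finset.univ : Finset {n // ¬ n ∈ R})) fun n _ => by simp [n.2],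
        mul_one]
      exact Finset.prod_congr (by ext; simp) fun n _ => by simp [n.2]
    · intro w' _ hne
      obtain ⟨n, hn⟩ := Function.ne_iff.1 hne
      rw [Finset.prod_eq_zero (Finset.mem_univ n.1), mul_zero]
      simp [n.2, hn]
    · simp
  · rw [← Fintype.prod_subtype_mul_prod_subtype (fun n => n ∈ R)]
    congr 1
    rw [Finset.prod_eq_one (s := (Finset.univ : Finset {n // ¬ n ∈ R})) fun n _ => by
      simp [n.2, Pi.single_apply, ite_pow], mul_one]
    exact Finset.prod_congr (by ext; simp) fun n _ => by simp [n.2]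

/-- The spectral norm of an unfolding is bounded by the spectral norm of the tensor, up to the
square root of the number of slices obtained by fixing all indices except one
representative `b B` of each block `B`. -/
theorem unfoldNorm_le_sqrt_mul_specNorm [Nonempty (Fin k)] (hd : ∀ n, 0 < d n)
    (A : ((n : Fin k) → Fin (d n)) → ℝ) {π : Finset (Finset (Fin k))} (hπ : IsPartition π)
    {b : Finset (Fin k) → Fin k} (hb : ∀ B ∈ π, b B ∈ B) :
    unfoldNorm d A π ≤
      √(∏ n : {n // ¬ n ∈ π.image b}, (d n.1 : ℝ)) * specNorm d A := by
  have hinj : Set.InjOn b π := fun B hB B' hB' h =>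
    hπ.eq_of_mem hB hB' (hb B hB) (h ▸ hb B' hB')
  have hprod (f : Finset (Fin k) → ℝ) :
      ∏ B ∈ π, f B = ∏ r : {n // n ∈ π.image b}, f (hπ.block r.1) := by
    rw [Finset.prod_coe_sort (π.image b) (fun r => f (hπ.block r)), Finset.prod_image hinj]
    exact Finset.prod_congr rfl fun B hB => by rw [hπ.block_eq hB (hb B hB)]
  have hsep {r j : Fin k} (hr : r ∈ π.image b) (hj : j ∈ hπ.block r) (hjr : j ≠ r) :
      j ∉ π.image b := by
    intro hjR
    obtain ⟨B, hB, rfl⟩ := Finset.mem_image.1 hr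
    obtain ⟨B', hB', rfl⟩ := Finset.mem_image.1 hjR
    rw [hπ.block_eq hB (hb B hB)] at hj
    exact hjr (congrArg b (hπ.eq_of_mem hB' hB (hb B' hB') hj))
  have hy₀ (B : Finset (Fin k)) : ∃ y : ((j : B) → Fin (d j.1)) → ℝ, ∑ v, y v ^ 2 = 1 := by
    have : Nonempty ((j : B) → Fin (d j.1)) := ⟨fun j => ⟨0, hd j.1⟩⟩
    exact exists_sum_sq_eq_one _
  choose y₀ hy₀ using hy₀
  refine csSup_le ⟨_, y₀, fun B _ => hy₀ B, rfl⟩ ?_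
  rintro _ ⟨y, hy, rfl⟩
  set e := Equiv.piEquivPiSubtypeProd (fun n => n ∈ π.image b) (fun n => Fin (d n)) with he
  let g (w : (n : {n // ¬ n ∈ π.image b}) → Fin (d n.1)) (r : {n // n ∈ π.image b})
      (t : Fin (d r.1)) : ℝ :=
    y (hπ.block r.1) fun j => Function.update (e.symm (fun n => ⟨0, hd n.1⟩, w)) r.1 t j.1
  have hg u w r : y (hπ.block r.1) (fun j => e.symm (u, w) j.1) = g w r (u r) := by
    refine congrArg _ (funext fun j => ?_)
    obtain ⟨j, hj⟩ := j
    by_cases hjr : j = r.1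
    · subst hjr
      simp [he, r.2]
    · have hjR := hsep r.2 hj hjr
      rw [Function.update_of_ne hjr]
      simp only [he, Equiv.piEquivPiSubtypeProd_symm_apply, dif_neg hjR]
  have hnorm : ∑ w, (∏ r, √(∑ t, g w r t ^ 2)) ^ 2 = 1 := by
    calc ∑ w, (∏ r, √(∑ t, g w r t ^ 2)) ^ 2
        = ∑ w, ∑ u : (r : {n // n ∈ π.image b}) → Fin (d r.1), ∏ r, g w r (u r) ^ 2 := by
          refine Finset.sum_congr rfl fun w _ => ?_
          rw [← Finset.prod_pow, ← Fintype.prod_sum (fun r t => g w r t ^ 2)]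
          exact Finset.prod_congr rfl fun r _ =>
            Real.sq_sqrt (Finset.sum_nonneg fun t _ => sq_nonneg _)
      _ = ∑ i : (n : Fin k) → Fin (d n), ∏ B ∈ π, y B (fun j => i j.1) ^ 2 := by
          rw [← Equiv.sum_comp e.symm, Fintype.sum_prod_type_right]
          simp_rw [hprod, hg]
      _ = 1 := by
          rw [hπ.sum_prod_block fun B v => y B v ^ 2]
          exact Finset.prod_eq_one hy
  calc ∑ i : (n : Fin k) → Fin (d n), A i * ∏ B ∈ π, y B (fun j => i j.1)
      = ∑ w, ∑ u, A (e.symm (u, w)) * ∏ r, g w r (u r) := by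
        rw [← Equiv.sum_comp e.symm, Fintype.sum_prod_type_right]
        simp_rw [hprod, hg]
    _ ≤ ∑ w, specNorm d A * ∏ r, √(∑ t, g w r t ^ 2) :=
        Finset.sum_le_sum fun w _ => sum_slice_le_specNorm_mul_prod A _ w (g w)
    _ = specNorm d A * ∑ w, 1 * ∏ r, √(∑ t, g w r t ^ 2) := by
        simp_rw [one_mul, Finset.mul_sum]
    _ ≤ specNorm d A * (√(∑ w : (n : {n // ¬ n ∈ π.image b}) → Fin (d n.1), 1 ^ 2) *
          √(∑ w, (∏ r, √(∑ t, g w r t ^ 2)) ^ 2)) :=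
        mul_le_mul_of_nonneg_left (Real.sum_mul_le_sqrt_mul_sqrt _ _ _) (specNorm_nonneg hd A)
    _ = _ := by
        rw [hnorm, Real.sqrt_one, mul_one, mul_comm]
        simp [Fintype.card_pi]

end TensorUnfolding

open TensorUnfolding in
/-- **Bottom-up inequality.** For an order-`k` tensor with all mode
dimensions equal to `d` and `1 ≤ ℓ ≤ k`,
`d^{−(k−ℓ)/2} · max_{π ∈ P^ℓ_{[k]}} ‖Unfold_π(A)‖_σ ≤ ‖A‖_σ ≤
 min_{π ∈ P^ℓ_{[k]}} ‖Unfold_π(A)‖_σ`. -/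
theorem bottom_up_inequality {k : ℕ} (d : ℕ) (hd : 1 ≤ d) (ℓ : ℕ)
    (hℓ : 1 ≤ ℓ) (hℓk : ℓ ≤ k)
    (A : (Fin k → Fin d) → ℝ) :
    (∀ π : Finset (Finset (Fin k)), IsPartition π → π.card = ℓ →
      (d : ℝ) ^ (-(((k - ℓ : ℕ) : ℝ)) / 2) * unfoldNorm (fun _ => d) A π ≤
        specNorm (fun _ => d) A) ∧
    (∀ π : Finset (Finset (Fin k)), IsPartition π → π.card = ℓ →
      specNorm (fun _ => d) A ≤ unfoldNorm (fun _ => d) A π) := by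
  have hd' : ∀ _ : Fin k, 0 < d := fun _ => hd
  refine ⟨fun π hπ hcard => ?_, fun π hπ _ => specNorm_le_unfoldNorm hd' A hπ⟩
  have : Nonempty (Fin k) := ⟨⟨0, by omega⟩⟩
  have hex : ∀ B : Finset (Fin k), ∃ n, B ∈ π → n ∈ B := fun B => by
    by_cases hB : B ∈ π
    · obtain ⟨n, hn⟩ := hπ.1 B hB
      exact ⟨n, fun _ => hn⟩
    · exact ⟨Classical.arbitrary _, fun h => absurd h hB⟩
  choose b hb using hex
  have hinj : Set.InjOn b π := fun B hB B' hB' h =>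
    hπ.eq_of_mem hB hB' (hb B hB) (h ▸ hb B' hB')
  have h := unfoldNorm_le_sqrt_mul_specNorm hd' A hπ hb
  have hR : Fintype.card {n // ¬ n ∈ π.image b} = k - ℓ := by
    rw [Fintype.card_subtype_compl, Fintype.card_coe, Finset.card_image_of_injOn hinj, hcard,
      Fintype.card_fin]
  have hd0 : (0 : ℝ) < d := by exact_mod_cast hd
  rw [Finset.prod_const, Finset.card_univ, hR, Real.sqrt_eq_rpow, ← Real.rpow_natCast,
    ← Real.rpow_mul hd0.le] at h
  refine (mul_le_mul_of_nonneg_left h (Real.rpow_nonneg hd0.le _)).trans_eq ?_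
  rw [← mul_assoc, ← Real.rpow_add hd0]
  ring_nf
  simp
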